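/- For every integer n ≥ 2, the Stirling derangement polynomial R_n(x) is symmetric (i.e., its coefficient sequence is palindromic: writing R_n(x) = Σ_j r_j x^j with r_j the coefficients, one has r_j = r_{D−j} where D = deg R_n plus the order of vanishing of R_n at 0, matched about the center of its support) and all of its zeros are real and simple. -/

import Mathlib

open scoped Classical
noncomputable section

/-- The multiset `{1,1,2,2,…,n,n}` as a list. -/
def baseList (n : ℕ) : List ℕ := (List.range n).flatMap (fun i => [i + 1, i + 1])

/-- A word is Stirling if whenever the same value occurs at positions `i < k`,
every entry strictly between them is greater than that value. -/
def IsStirlingWord (l : List ℕ) : Prop :=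
  ∀ i j k : Fin l.length, i < j → j < k → l.get i = l.get k → l.get i < l.get j

/-- The set `Q_n` of Stirling permutations of order `n`:  rearrangements of the
multiset `{1,1,2,2,…,n,n}` in which all entries between the two occurrences of any
value exceed that value. -/
def stirlingPerms (n : ℕ) : Finset (List ℕ) :=
  ((baseList n).permutations.toFinset).filter IsStirlingWord

/-- Number of descents of `σ ∈ Q_n`: indices `i ∈ {1,…,2n}` (here 0-based) with
`σ_i > σ_{i+1}`, with the convention `σ_{2n+1} = 0`. -/
def desList (l : List ℕ) : ℕ :=
  ((Finset.range l.length).filter (fun i => l.getD (i + 1) 0 < l.getD i 0)).card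

/-- The second-order Eulerian polynomial `C_n(x) = ∑_{σ ∈ Q_n} x^{des σ}`. -/
def Cpoly (n : ℕ) : Polynomial ℚ :=
  ∑ σ ∈ stirlingPerms n, Polynomial.X ^ desList σ

/-- A list of cycles is a valid standard cycle form of a Stirling permutation of the
second kind of order `n` if:  the cycles are disjoint and together use each of
`1,1,2,2,…,n,n` exactly once; both copies of any value lie in the same cycle; each
cycle starts with (one of) its smallest entries; the cycles are listed in increasing
order of their smallest (first) entries; and the word of each cycle reduces to a
Stirling permutation. -/
def IsStirling2 (n : ℕ) (c : List (List ℕ)) : Prop :=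
  c.flatten.Perm (baseList n) ∧
  (∀ w ∈ c, w ≠ [] ∧ (∀ v ∈ w, w.count v = 2) ∧ (∀ v ∈ w, w.headI ≤ v) ∧
      IsStirlingWord w) ∧
  c.Chain' (fun w₁ w₂ => w₁.headI < w₂.headI)

/-- The set `Q_n²` of Stirling permutations of the second kind of order `n`,
each recorded as its standard cycle form (a list of cycles). -/
def stirling2 (n : ℕ) : Finset (List (List ℕ)) :=
  ((((baseList n).permutations.toFinset) ×ˢ (Finset.univ : Finset (Composition (2 * n)))).image
      (fun p => p.1.splitWrtComposition p.2)).filter (IsStirling2 n)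

/-- `cyc(σ)`: the number of cycles. -/
def cyc (c : List (List ℕ)) : ℕ := c.length

/-- `cplat(σ)`: the number of cycle plateaus, i.e. entries `c_i` of a cycle
`(c_1,…,c_{2k})` with `c_i = c_{i+1}`, `1 ≤ i < 2k`. -/
def cplat (c : List (List ℕ)) : ℕ :=
  (c.map (fun w => ((Finset.range w.length).filter
    (fun i => i + 1 < w.length ∧ w.getD i 0 = w.getD (i + 1) 0)).card)).sum

/-- `casc(σ)`: the number of cycle ascents, i.e. entries `c_i` of a cycle
`(c_1,…,c_{2k})` with `c_i < c_{i+1}`, `1 ≤ i < 2k`. -/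
def casc (c : List (List ℕ)) : ℕ :=
  (c.map (fun w => ((Finset.range w.length).filter
    (fun i => i + 1 < w.length ∧ w.getD i 0 < w.getD (i + 1) 0)).card)).sum

/-- `cap(σ)`: the number of cycle ascent plateaus, i.e. entries `c_i` of a cycle
`(c_1,…,c_{2k})` with `c_{i-1} < c_i = c_{i+1}`, `2 ≤ i ≤ 2k-1`. -/
def capSt (c : List (List ℕ)) : ℕ :=
  (c.map (fun w => ((Finset.range w.length).filter
    (fun i => 0 < i ∧ i + 1 < w.length ∧
      w.getD (i - 1) 0 < w.getD i 0 ∧ w.getD i 0 = w.getD (i + 1) 0)).card)).sum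

/-- `fix(σ)`: the number of fixed points, i.e. values `k` with `(k,k)` a cycle of `σ`. -/
def fixSt (c : List (List ℕ)) : ℕ :=
  ((Finset.range c.length).filter (fun i => ∃ k : ℕ, c.getD i [] = [k, k])).card

/-- The Stirling derangement polynomial `R_n(x) = ∑_{σ ∈ DQ_n} x^{cap(σ)}`, summed over
fixed-point-free Stirling permutations of the second kind of order `n` (here with real
coefficients). -/
def Rx (n : ℕ) : Polynomial ℝ :=
  ∑ σ ∈ (stirling2 n).filter (fun σ => fixSt σ = 0), Polynomial.X ^ capSt σ

section DerangementSequence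

open Polynomial

/-- The recurrence satisfied by the Stirling derangement polynomials. -/
structure IsDerangementSeq (R : ℕ → ℝ[X]) : Prop where
  zero : R 0 = 1
  one : R 1 = 0
  step : ∀ n, R (n + 2) = C (2 * ((n : ℝ) + 1)) * X * (R (n + 1) + R n) +
    C 2 * X * (1 - X) * derivative (R (n + 1))

end DerangementSequence

namespace IsDerangementSeq

open Polynomial

variable {R : ℕ → ℝ[X]}

lemma coeff_zero (h : IsDerangementSeq R) (n : ℕ) : (R (n + 1)).coeff 0 = 0 := by
  cases n with
  | zero => simp [h.one]
  | succ n => rw [h.step]; simp [mul_coeff_zero]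

lemma coeff_step (h : IsDerangementSeq R) (n j : ℕ) :
    (R (n + 2)).coeff (j + 1) = 2 * ((n : ℝ) + 1 - j) * (R (n + 1)).coeff j +
      2 * ((j : ℝ) + 1) * (R (n + 1)).coeff (j + 1) + 2 * ((n : ℝ) + 1) * (R n).coeff j := by
  have e : R (n + 2) = X * (C (2 * ((n : ℝ) + 1)) * (R (n + 1) + R n) +
      C 2 * derivative (R (n + 1)) - C 2 * (X * derivative (R (n + 1)))) := by
    rw [h.step]; ring
  rw [e, coeff_X_mul]
  simp only [coeff_sub, coeff_add, coeff_C_mul, coeff_derivative]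
  cases j with
  | zero => simp; ring
  | succ j => simp only [coeff_X_mul, coeff_derivative]; push_cast; ring

lemma coeff_eq_zero_of_lt (h : IsDerangementSeq R) (n : ℕ) :
    ∀ j, n < j → (R n).coeff j = 0 := by
  induction n using Nat.strong_induction_on with
  | _ n ih =>
    intro j hj
    match n, j with
    | 0, j => rw [h.zero, coeff_one, if_neg (by omega)]
    | 1, j => simp [h.one]
    | n + 2, 0 => omega
    | n + 2, j + 1 =>
      rw [h.coeff_step, ih (n + 1) (by omega) j (by omega),
        ih (n + 1) (by omega) (j + 1) (by omega), ih n (by omega) j (by omega)]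
      ring

lemma coeff_symm (h : IsDerangementSeq R) (n : ℕ) :
    ∀ i j, i + j = n → (R n).coeff i = (R n).coeff j := by
  induction n using Nat.strong_induction_on with
  | _ n ih =>
    intro i j hij
    match n with
    | 0 => obtain ⟨rfl, rfl⟩ : i = 0 ∧ j = 0 := by omega
           rfl
    | 1 => simp [h.one]
    | n + 2 =>
      have edge : (R (n + 2)).coeff (n + 2) = 0 := by
        rw [h.coeff_step, h.coeff_eq_zero_of_lt (n + 1) (n + 1 + 1) (by omega),
          h.coeff_eq_zero_of_lt n (n + 1) (by omega)]
        push_cast; ring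
      match i, j with
      | 0, j => rw [h.coeff_zero (n + 1), show j = n + 2 by omega, edge]
      | i, 0 => rw [h.coeff_zero (n + 1), show i = n + 2 by omega, edge]
      | i + 1, j + 1 =>
        rw [h.coeff_step, h.coeff_step, ih (n + 1) (by omega) i (j + 1) (by omega),
          ih (n + 1) (by omega) (i + 1) j (by omega), ih n (by omega) i j (by omega)]
        have : (n : ℝ) = i + j := by
          rw [show n = i + j by omega]; push_cast; rfl
        rw [this]; ring

lemma coeff_one_pos (h : IsDerangementSeq R) (n : ℕ) : 0 < (R (n + 2)).coeff 1 := by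
  induction n with
  | zero => rw [h.coeff_step]; simp [h.zero, h.one]
  | succ n ih =>
    rw [h.coeff_step, h.coeff_zero (n + 1), h.coeff_zero n]
    simpa using ih

lemma natDegree_eq (h : IsDerangementSeq R) (n : ℕ) : (R (n + 2)).natDegree = n + 1 := by
  apply natDegree_eq_of_le_of_coeff_ne_zero
  · rw [natDegree_le_iff_coeff_eq_zero]
    intro N hN
    rcases Nat.lt_or_ge (n + 2) N with hlt | hge
    · exact h.coeff_eq_zero_of_lt _ _ hlt
    · rw [h.coeff_symm (n + 2) N 0 (by omega), h.coeff_zero (n + 1)]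
  · rw [h.coeff_symm (n + 2) (n + 1) 1 (by omega)]
    exact (h.coeff_one_pos n).ne'

lemma natTrailingDegree_eq (h : IsDerangementSeq R) (n : ℕ) :
    (R (n + 2)).natTrailingDegree = 1 := by
  apply le_antisymm
  · exact natTrailingDegree_le_of_ne_zero (h.coeff_one_pos n).ne'
  · apply le_natTrailingDegree
    · intro h0
      simpa [h0] using h.coeff_one_pos n
    · intro m hm
      obtain rfl : m = 0 := by omega
      exact h.coeff_zero (n + 1)

lemma eq_X_mul_divX (h : IsDerangementSeq R) (n : ℕ) : R (n + 1) = X * divX (R (n + 1)) := by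
  conv_lhs => rw [← X_mul_divX_add (R (n + 1)), h.coeff_zero n, C_0, add_zero]

lemma divX_step (h : IsDerangementSeq R) (n : ℕ) :
    divX (R (n + 3)) = C (2 * ((n : ℝ) + 2)) * X * (divX (R (n + 2)) + divX (R (n + 1))) +
      C 2 * (1 - X) * (divX (R (n + 2)) + X * derivative (divX (R (n + 2)))) := by
  have e := h.step (n + 1)
  rw [h.eq_X_mul_divX (n + 2), h.eq_X_mul_divX (n + 1), h.eq_X_mul_divX n, derivative_mul,
    derivative_X] at e
  apply mul_left_cancel₀ (X_ne_zero (R := ℝ))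
  rw [e, show 2 * (((n + 1 : ℕ) : ℝ) + 1) = 2 * ((n : ℝ) + 2) by push_cast; ring]
  ring

lemma natDegree_divX (h : IsDerangementSeq R) (n : ℕ) : (divX (R (n + 2))).natDegree = n := by
  rw [natDegree_divX_eq_natDegree_tsub_one, h.natDegree_eq]; rfl

lemma leadingCoeff_divX_pos (h : IsDerangementSeq R) (n : ℕ) :
    0 < (divX (R (n + 2))).leadingCoeff := by
  rw [leadingCoeff, h.natDegree_divX, coeff_divX, h.coeff_symm (n + 2) (n + 1) 1 (by omega)]
  exact h.coeff_one_pos n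

lemma eval_zero_divX_pos (h : IsDerangementSeq R) (n : ℕ) :
    0 < (divX (R (n + 2))).eval 0 := by
  rw [← coeff_zero_eq_eval_zero, coeff_divX]
  exact h.coeff_one_pos n

end IsDerangementSeq

section Interlacing

open Polynomial Lagrange

lemma eq_C_mul_nodal_of_eval_eq_zero {p : ℝ[X]} {m : ℕ} {x : ℕ → ℝ} (hdeg : p.natDegree = m)
    (hlead : 0 < p.leadingCoeff) (hx : ∀ i j, i < j → j < m → x j < x i)
    (hroot : ∀ i < m, p.eval (x i) = 0) :
    p = C p.leadingCoeff * nodal (Finset.range m) x := by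
  have hp : p ≠ 0 := leadingCoeff_ne_zero.mp hlead.ne'
  have hinj : Set.InjOn x (Finset.range m : Set ℕ) := by
    intro i hi j hj hij
    simp only [Finset.coe_range, Set.mem_Iio] at hi hj
    rcases lt_trichotomy i j with hlt | heq | hgt
    · exact absurd hij (hx i j hlt hj).ne'
    · exact heq
    · exact absurd hij (hx j i hgt hi).ne
  have hdeg' : p.degree = m := by rw [degree_eq_natDegree hp, hdeg]
  refine eq_of_degree_sub_lt_of_eval_index_eq (Finset.range m) hinj ?_ ?_
  · rw [Finset.card_range, ← hdeg']
    refine degree_sub_lt_left ?_ hp ?_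
    · rw [degree_C_mul hlead.ne', degree_nodal, Finset.card_range, hdeg']
    · rw [leadingCoeff_mul, leadingCoeff_C, nodal_monic.leadingCoeff, mul_one]
  · intro i hi
    rw [hroot i (Finset.mem_range.mp hi), eval_mul, eval_nodal_at_node hi, mul_zero]

lemma neg_one_pow_mul_prod_pos {s : Finset ℕ} {x : ℕ → ℝ} {z : ℝ} {i : ℕ}
    (hi : ∀ j < i, j ∈ s) (hlt : ∀ j ∈ s, j < i → z < x j) (hge : ∀ j ∈ s, i ≤ j → x j < z) :
    0 < (-1) ^ i * ∏ j ∈ s, (z - x j) := by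
  have hsub : Finset.range i ⊆ s := fun j hj => hi j (Finset.mem_range.mp hj)
  rw [← Finset.prod_sdiff hsub, mul_comm, mul_assoc]
  apply mul_pos
  · refine Finset.prod_pos fun j hj => ?_
    rw [Finset.mem_sdiff, Finset.mem_range, not_lt] at hj
    exact sub_pos.mpr (hge j hj.1 hj.2)
  · have e : (∏ j ∈ Finset.range i, (z - x j)) * (-1) ^ i = ∏ j ∈ Finset.range i, (x j - z) := by
      rw [← Finset.card_range i, ← Finset.prod_const, Finset.card_range, ← Finset.prod_mul_distrib]
      exact Finset.prod_congr rfl fun j _ => by ring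
    rw [e]
    exact Finset.prod_pos fun j hj =>
      sub_pos.mpr (hlt j (hsub hj) (Finset.mem_range.mp hj))

lemma exists_root_of_mul_neg {p : ℝ[X]} {a b : ℝ} (hab : a < b)
    (h : p.eval a * p.eval b < 0) : ∃ y, a < y ∧ y < b ∧ p.eval y = 0 := by
  rcases mul_neg_iff.mp h with ⟨ha, hb⟩ | ⟨ha, hb⟩
  · obtain ⟨y, hy, hy0⟩ := intermediate_value_Ioo' hab.le p.continuousOn ⟨hb, ha⟩
    exact ⟨y, hy.1, hy.2, hy0⟩
  · obtain ⟨y, hy, hy0⟩ := intermediate_value_Ioo hab.le p.continuousOn ⟨ha, hb⟩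
    exact ⟨y, hy.1, hy.2, hy0⟩

lemma exists_lt_neg_one_pow_mul_eval_pos {p : ℝ[X]} (hdeg : 0 < p.natDegree)
    (hlead : 0 < p.leadingCoeff) (c : ℝ) :
    ∃ b < c, 0 < (-1) ^ p.natDegree * p.eval b := by
  set q : ℝ[X] := C ((-1) ^ p.natDegree) * p.comp (-X)
  have hX : (-X : ℝ[X]).natDegree = 1 := by rw [natDegree_neg, natDegree_X]
  have hc : ((-1 : ℝ) ^ p.natDegree) ≠ 0 := pow_ne_zero _ (by norm_num)
  have hqdeg : 0 < q.degree := by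
    rw [← natDegree_pos_iff_degree_pos, natDegree_C_mul hc, natDegree_comp, hX, mul_one]
    exact hdeg
  have hqlead : 0 ≤ q.leadingCoeff := by
    rw [leadingCoeff_mul, leadingCoeff_C, leadingCoeff_comp (by rw [hX]; norm_num),
      leadingCoeff_neg, leadingCoeff_X, mul_left_comm, ← mul_pow]
    norm_num
    exact hlead.le
  have ht := tendsto_atTop_of_leadingCoeff_nonneg q hqdeg hqlead
  obtain ⟨t, ht1, ht2⟩ := ((ht.eventually_gt_atTop 0).and (Filter.eventually_gt_atTop (-c))).exists
  refine ⟨-t, by linarith, ?_⟩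
  simpa [q] using ht1

/-- One step of interlacing: if the values of `q` at the points `0 = u 0 > u 1 > ⋯`, with
`u (i + 1) = x i`, alternate in sign, then `q` has a root in each gap and one to the left. -/
lemma exists_interlacing_roots {q : ℝ[X]} {m : ℕ} {x : ℕ → ℝ} (hdeg : q.natDegree = m + 1)
    (hlead : 0 < q.leadingCoeff) (hq0 : 0 < q.eval 0) (hneg : ∀ i < m, x i < 0)
    (hx : ∀ i j, i < j → j < m → x j < x i)
    (hsign : ∀ i < m, (-1) ^ i * q.eval (x i) < 0) :
    ∃ y : ℕ → ℝ, (∀ i < m + 1, y i < 0 ∧ q.eval (y i) = 0) ∧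
      (∀ i < m + 1, ∀ j < m, (j < i → y i < x j) ∧ (i ≤ j → x j < y i)) ∧
      (∀ i j, i < j → j < m + 1 → y j < y i) := by
  obtain ⟨b, hb, hbpos⟩ := exists_lt_neg_one_pow_mul_eval_pos (by omega) hlead
    (if m = 0 then 0 else x (m - 1))
  rw [hdeg] at hbpos
  let u : ℕ → ℝ := fun i => if i = 0 then 0 else if i ≤ m then x (i - 1) else b
  have u_zero : u 0 = 0 := rfl
  have u_succ : ∀ i < m, u (i + 1) = x i := fun i hi => by
    simp only [u, if_neg i.succ_ne_zero, if_pos (show i + 1 ≤ m from hi), Nat.add_sub_cancel]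
  have u_last : u (m + 1) = b := by
    simp only [u, if_neg m.succ_ne_zero, if_neg (show ¬ m + 1 ≤ m by omega)]
  have u_anti : ∀ i < m + 1, u (i + 1) < u i := by
    intro i hi
    rcases Nat.lt_succ_iff_lt_or_eq.mp hi with hlt | rfl
    · rw [u_succ i hlt]
      cases i with
      | zero => exact hneg 0 hlt
      | succ i => rw [u_succ i (by omega)]; exact hx i (i + 1) (by omega) hlt
    · rw [u_last]
      cases i with
      | zero => simpa [u_zero] using hb
      | succ i => rw [u_succ i (by omega)]; simpa using hb
  have u_sign : ∀ i ≤ m + 1, 0 < (-1) ^ i * q.eval (u i) := by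
    intro i hi
    cases i with
    | zero => simpa [u_zero] using hq0
    | succ i =>
      rcases Nat.lt_succ_iff_lt_or_eq.mp (show i < m + 1 by omega) with hlt | rfl
      · rw [u_succ i hlt, pow_succ]
        linarith [hsign i hlt]
      · rwa [u_last]
  have key : ∀ i, ∃ y, i < m + 1 → u (i + 1) < y ∧ y < u i ∧ q.eval y = 0 := by
    intro i
    by_cases hi : i < m + 1
    · obtain ⟨y, hy⟩ := exists_root_of_mul_neg (p := q) (u_anti i hi) (by
        have h1 := mul_pos (u_sign i hi.le) (u_sign (i + 1) hi)
        have h2 : ((-1 : ℝ) ^ i) * (-1) ^ i = 1 := by rw [← mul_pow]; norm_num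
        rw [pow_succ] at h1
        have h3 : (-1) ^ i * q.eval (u i) * ((-1) ^ i * (-1) * q.eval (u (i + 1))) =
          -(((-1) ^ i * (-1) ^ i) * (q.eval (u (i + 1)) * q.eval (u i))) := by ring
        rw [h3, h2] at h1
        linarith)
      exact ⟨y, fun _ => hy⟩
    · exact ⟨0, fun h => absurd h hi⟩
  choose y hy using key
  have u_le : ∀ i j, i ≤ j → j ≤ m + 1 → u j ≤ u i := by
    intro i j hij
    induction j, hij using Nat.le_induction with
    | base => intro; exact le_rfl
    | succ j _ ih => intro hj; exact (u_anti j (by omega)).le.trans (ih (by omega))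
  refine ⟨y, fun i hi => ⟨?_, (hy i hi).2.2⟩, fun i hi j hj => ⟨fun hji => ?_, fun hij => ?_⟩,
    fun i j hij hj => ?_⟩
  · exact (hy i hi).2.1.trans_le (u_le 0 i (Nat.zero_le i) hi.le)
  · rw [← u_succ j hj]
    exact (hy i hi).2.1.trans_le (u_le (j + 1) i hji hi.le)
  · rw [← u_succ j hj]
    exact (u_le (i + 1) (j + 1) (by omega) (by omega)).trans_lt (hy i hi).1
  · exact ((hy j hj).2.1.trans_le (u_le (i + 1) j hij hj.le)).trans (hy i (by omega)).1

end Interlacing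

namespace IsDerangementSeq

open Polynomial Lagrange

variable {R : ℕ → ℝ[X]}

lemma exists_roots (h : IsDerangementSeq R) (m : ℕ) :
    ∃ x : ℕ → ℝ, (∀ i < m + 1, x i < 0 ∧ (divX (R (m + 3))).eval (x i) = 0) ∧
      (∀ i < m + 1, 0 < (-1) ^ i * (divX (R (m + 2))).eval (x i)) ∧
      (∀ i j, i < j → j < m + 1 → x j < x i) := by
  induction m with
  | zero =>
    have h2 : divX (R 2) = C ((divX (R 2)).coeff 0) :=
      eq_C_of_natDegree_eq_zero (h.natDegree_divX 0)
    obtain ⟨y, hy, -, hy'⟩ := exists_interlacing_roots (m := 0) (x := fun _ => 0)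
      (h.natDegree_divX 1) (h.leadingCoeff_divX_pos 1) (h.eval_zero_divX_pos 1)
      (by simp) (by simp) (by simp)
    refine ⟨y, hy, fun i hi => ?_, hy'⟩
    obtain rfl : i = 0 := by omega
    have h3 := h.eval_zero_divX_pos 0
    rw [zero_add, h2, eval_C] at h3
    rw [zero_add, h2, eval_C]
    simpa using h3
  | succ m ih =>
    obtain ⟨x, hroot, hsign, hx⟩ := ih
    have hlead := h.leadingCoeff_divX_pos (m + 1)
    have hfac := eq_C_mul_nodal_of_eval_eq_zero (h.natDegree_divX (m + 1)) hlead hx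
      (fun i hi => (hroot i hi).2)
    obtain ⟨y, hy, hxy, hy'⟩ := exists_interlacing_roots (q := divX (R (m + 4))) (m := m + 1)
      (h.natDegree_divX (m + 2)) (h.leadingCoeff_divX_pos (m + 2)) (h.eval_zero_divX_pos (m + 2))
      (fun i hi => (hroot i hi).1) hx (fun i hi => by
        obtain ⟨hneg, hzero⟩ := hroot i hi
        have hderiv : 0 < (-1) ^ i * (derivative (divX (R (m + 3)))).eval (x i) := by
          rw [hfac, derivative_C_mul, eval_C_mul,
            eval_nodal_derivative_eval_node_eq (Finset.mem_range.mpr hi), eval_nodal, mul_left_comm]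
          refine mul_pos hlead (neg_one_pow_mul_prod_pos ?_ ?_ ?_)
          · intro j hj
            simp only [Finset.mem_erase, Finset.mem_range]
            omega
          · intro j hj hji
            exact hx j i hji hi
          · intro j hj hij
            simp only [Finset.mem_erase, Finset.mem_range] at hj
            exact hx i j (by omega) hj.2
        have e : (-1) ^ i * (divX (R (m + 4))).eval (x i) =
            (2 * (m + 3) * ((-1) ^ i * (divX (R (m + 2))).eval (x i)) +
              2 * (1 - x i) * ((-1) ^ i * (derivative (divX (R (m + 3)))).eval (x i))) * x i := by
          rw [h.divX_step (m + 1)]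
          simp only [eval_add, eval_mul, eval_C, eval_X, eval_sub, eval_one, hzero]
          push_cast
          ring
        rw [e]
        refine mul_neg_of_pos_of_neg (add_pos (mul_pos (by positivity) (hsign i hi))
          (mul_pos (by linarith) hderiv)) hneg)
    refine ⟨y, hy, fun i hi => ?_, hy'⟩
    rw [show m + 1 + 2 = m + 3 from rfl, hfac, eval_C_mul, eval_nodal, mul_left_comm]
    refine mul_pos hlead (neg_one_pow_mul_prod_pos ?_ ?_ ?_)
    · intro j hj
      exact Finset.mem_range.mpr (by omega)
    · intro j hj hji
      exact (hxy i hi j (Finset.mem_range.mp hj)).1 hji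
    · intro j hj hij
      exact (hxy i hi j (Finset.mem_range.mp hj)).2 hij

lemma exists_eq_C_mul_nodal (h : IsDerangementSeq R) (n : ℕ) :
    ∃ (c : ℝ) (x : ℕ → ℝ), c ≠ 0 ∧ Set.InjOn x (Finset.range (n + 1) : Set ℕ) ∧
      R (n + 2) = C c * nodal (Finset.range (n + 1)) x := by
  obtain ⟨x, hx, hanti⟩ : ∃ x : ℕ → ℝ,
      (∀ i < n, x i < 0 ∧ (divX (R (n + 2))).eval (x i) = 0) ∧
        (∀ i j, i < j → j < n → x j < x i) := by
    cases n with
    | zero => exact ⟨fun _ => 0, by simp, by simp⟩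
    | succ n =>
      obtain ⟨x, hx, -, hanti⟩ := h.exists_roots n
      exact ⟨x, hx, hanti⟩
  let y : ℕ → ℝ := fun i => if i = 0 then 0 else x (i - 1)
  have hy : ∀ i j, i < j → j < n + 1 → y j < y i := by
    intro i j hij hj
    obtain ⟨j, rfl⟩ : ∃ k, j = k + 1 := ⟨j - 1, by omega⟩
    cases i with
    | zero => simpa [y] using (hx j (by omega)).1
    | succ i => simpa [y] using hanti i j (by omega) (by omega)
  have hlead : 0 < (R (n + 2)).leadingCoeff := by
    rw [h.eq_X_mul_divX (n + 1), leadingCoeff_mul, leadingCoeff_X, one_mul]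
    exact h.leadingCoeff_divX_pos n
  refine ⟨_, y, hlead.ne', ?_, eq_C_mul_nodal_of_eval_eq_zero (h.natDegree_eq n) hlead hy ?_⟩
  · intro i hi j hj hij
    simp only [Finset.coe_range, Set.mem_Iio] at hi hj
    rcases lt_trichotomy i j with hlt | heq | hgt
    · exact absurd hij (hy i j hlt hj).ne'
    · exact heq
    · exact absurd hij (hy j i hgt hi).ne
  · intro i hi
    rw [h.eq_X_mul_divX (n + 1), eval_mul, eval_X]
    cases i with
    | zero => simp [y]
    | succ i => simp [y, (hx i (by omega)).2]

lemma im_eq_zero_of_aeval_eq_zero (h : IsDerangementSeq R) (n : ℕ) (z : ℂ)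
    (hz : aeval z (R (n + 2)) = 0) : z.im = 0 := by
  obtain ⟨c, x, hc, -, e⟩ := h.exists_eq_C_mul_nodal n
  rw [e, nodal_eq, map_mul, map_prod, aeval_C, mul_eq_zero, Finset.prod_eq_zero_iff] at hz
  rcases hz with hz | ⟨i, -, hi⟩
  · simp [hc] at hz
  · rw [map_sub, aeval_X, aeval_C, sub_eq_zero] at hi
    simp [hi]

lemma rootMultiplicity_le_one (h : IsDerangementSeq R) (n : ℕ) (x : ℝ) :
    (R (n + 2)).rootMultiplicity x ≤ 1 := by
  obtain ⟨c, v, hc, hv, e⟩ := h.exists_eq_C_mul_nodal n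
  rw [← count_roots, e, roots_C_mul _ hc, nodal_eq, count_roots]
  exact rootMultiplicity_le_one_of_separable
    (separable_prod_X_sub_C_iff'.mpr fun i hi j hj hij => hv hi hj hij) x

end IsDerangementSeq

section Statistics

/-- The number of ascent plateaus of a word, computed recursively. -/
def ascentPlateaus : List ℕ → ℕ
  | a :: b :: c :: l => (if a < b ∧ b = c then 1 else 0) + ascentPlateaus (b :: c :: l)
  | _ => 0

lemma card_ascentPlateau_positions (w : List ℕ) :
    ((Finset.range w.length).filter (fun i => 0 < i ∧ i + 1 < w.length ∧
      w.getD (i - 1) 0 < w.getD i 0 ∧ w.getD i 0 = w.getD (i + 1) 0)).card =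
      ascentPlateaus w := by
  induction w using ascentPlateaus.induct with
  | case1 a b c l ih =>
    rw [ascentPlateaus, ← ih, Finset.card_filter, Finset.card_filter]
    simp only [List.length_cons]
    rw [Finset.sum_range_succ', Finset.sum_range_succ', Finset.sum_range_succ' _ (l.length + 1)]
    simp
    ring
  | case2 w hw =>
    match w with
    | [] => simp [ascentPlateaus]
    | [a] => simp [ascentPlateaus]
    | [a, b] =>
      rw [ascentPlateaus, Finset.card_eq_zero, Finset.filter_eq_empty_iff]
      · simp only [List.length_cons, List.length_nil]
        omega
      · simp
    | a :: b :: c :: l => exact absurd rfl (hw a b c l)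

lemma capSt_nil : capSt [] = 0 := rfl

lemma capSt_cons (w : List ℕ) (c : List (List ℕ)) :
    capSt (w :: c) = ascentPlateaus w + capSt c := by
  rw [capSt, List.map_cons, List.sum_cons, card_ascentPlateau_positions]
  rfl

lemma fixSt_nil : fixSt [] = 0 := rfl

lemma fixSt_cons (w : List ℕ) (c : List (List ℕ)) :
    fixSt (w :: c) = (if ∃ k, w = [k, k] then 1 else 0) + fixSt c := by
  rw [fixSt, fixSt, Finset.card_filter, Finset.card_filter, List.length_cons,
    Finset.sum_range_succ', add_comm]
  rfl

lemma capSt_append (c d : List (List ℕ)) : capSt (c ++ d) = capSt c + capSt d := by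
  simp [capSt]

lemma fixSt_append (c d : List (List ℕ)) : fixSt (c ++ d) = fixSt c + fixSt d := by
  induction c with
  | nil => simp [fixSt_nil]
  | cons w c ih => rw [List.cons_append, fixSt_cons, fixSt_cons, ih, add_assoc]

end Statistics

section Insertion

/-- All words obtained from a word by inserting `a a` directly after one of its entries. -/
def insertTwice (a : ℕ) : List ℕ → List (List ℕ)
  | [] => []
  | b :: l => (b :: a :: a :: l) :: (insertTwice a l).map (b :: ·)

/-- All lists of cycles obtained by inserting `a a` directly after an entry of some cycle. -/
def insertInCycle (a : ℕ) : List (List ℕ) → List (List (List ℕ))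
  | [] => []
  | w :: c => (insertTwice a w).map (· :: c) ++ (insertInCycle a c).map (w :: ·)

lemma mem_insertTwice {a : ℕ} {w w' : List ℕ} :
    w' ∈ insertTwice a w ↔ ∃ l₁ l₂, l₁ ≠ [] ∧ w = l₁ ++ l₂ ∧ w' = l₁ ++ a :: a :: l₂ := by
  induction w generalizing w' with
  | nil => simp [insertTwice]
  | cons b l ih =>
    simp only [insertTwice, List.mem_cons, List.mem_map, ih]
    constructor
    · rintro (rfl | ⟨_, ⟨l₁, l₂, h, rfl, rfl⟩, rfl⟩)
      · exact ⟨[b], l, by simp⟩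
      · exact ⟨b :: l₁, l₂, by simp⟩
    · rintro ⟨l₁, l₂, h, e, rfl⟩
      match l₁ with
      | [b'] => simp_all
      | b' :: b'' :: l₁ =>
        obtain ⟨rfl, rfl⟩ : b = b' ∧ l = b'' :: l₁ ++ l₂ := by simpa using e
        exact Or.inr ⟨_, ⟨b'' :: l₁, l₂, by simp⟩, rfl⟩

lemma mem_insertInCycle {a : ℕ} {c c' : List (List ℕ)} :
    c' ∈ insertInCycle a c ↔ ∃ c₁ w w' c₂, w' ∈ insertTwice a w ∧ c = c₁ ++ w :: c₂ ∧
      c' = c₁ ++ w' :: c₂ := by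
  induction c generalizing c' with
  | nil => simp [insertInCycle]
  | cons w c ih =>
    simp only [insertInCycle, List.mem_append, List.mem_map, ih]
    constructor
    · rintro (⟨w', h, rfl⟩ | ⟨_, ⟨c₁, v, v', c₂, h, rfl, rfl⟩, rfl⟩)
      · exact ⟨[], w, w', c, h, rfl, rfl⟩
      · exact ⟨w :: c₁, v, v', c₂, h, rfl, rfl⟩
    · rintro ⟨c₁, v, v', c₂, h, e, rfl⟩
      cases c₁ with
      | nil =>
        obtain ⟨rfl, rfl⟩ : w = v ∧ c = c₂ := by simpa using e
        exact Or.inl ⟨v', h, rfl⟩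
      | cons u c₁ =>
        obtain ⟨rfl, rfl⟩ : w = u ∧ c = c₁ ++ v :: c₂ := by simpa using e
        exact Or.inr ⟨_, ⟨c₁, v, v', c₂, h, rfl, rfl⟩, rfl⟩

lemma insertTwice_nodup {a : ℕ} {w : List ℕ} (ha : a ∉ w) : (insertTwice a w).Nodup := by
  induction w with
  | nil => exact List.nodup_nil
  | cons b l ih =>
    rw [List.mem_cons, not_or] at ha
    refine List.nodup_cons.mpr ⟨?_, (ih ha.2).map (List.cons_injective)⟩
    rw [List.mem_map]
    rintro ⟨w', hw', e⟩
    obtain ⟨l₁, l₂, h, rfl, rfl⟩ := mem_insertTwice.mp hw'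
    obtain ⟨x, l₁, rfl⟩ := List.exists_cons_of_ne_nil h
    have : x = a := by simpa using congrArg (fun l => l.getD 1 0) e
    exact ha.2 (by simp [this])

lemma insertInCycle_nodup {a : ℕ} {c : List (List ℕ)} (ha : ∀ w ∈ c, a ∉ w) :
    (insertInCycle a c).Nodup := by
  induction c with
  | nil => exact List.nodup_nil
  | cons w c ih =>
    have haw := ha w (by simp)
    refine List.Nodup.append ((insertTwice_nodup haw).map fun _ _ h => (List.cons.inj h).1)
      ((ih fun v hv => ha v (by simp [hv])).map (List.cons_injective)) ?_
    intro c' h1 h2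
    rw [List.mem_map] at h1 h2
    obtain ⟨w', hw', rfl⟩ := h1
    obtain ⟨c'', -, e⟩ := h2
    obtain ⟨l₁, l₂, h, e1, e2⟩ := mem_insertTwice.mp hw'
    rw [← (List.cons.inj e).1] at e2
    exact haw (by rw [e2]; simp)

end Insertion

section InsertionStatistics

variable {M : Type*} [CommRing M]

lemma ascentPlateaus_cons_of_le {a : ℕ} {l : List ℕ} (h : ∀ x ∈ l.head?, x ≤ a) :
    ascentPlateaus (a :: l) = ascentPlateaus l := by
  match l with
  | [] => rfl
  | [b] => rfl
  | b :: c :: l =>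
    have hb : ¬ a < b := (h b rfl).not_gt
    simp [ascentPlateaus, hb]

lemma ascentPlateaus_cons_insert {a b : ℕ} {l : List ℕ} (hb : b < a) (hl : ∀ x ∈ l, x < a) :
    ascentPlateaus (b :: a :: a :: l) = ascentPlateaus l + 1 := by
  have hl' : ∀ x ∈ l.head?, x ≤ a := fun x hx => (hl x (List.mem_of_mem_head? hx)).le
  rw [ascentPlateaus, if_pos ⟨hb, rfl⟩, ascentPlateaus_cons_of_le (by simp),
    ascentPlateaus_cons_of_le hl', add_comm]

lemma sum_insertTwice (a : ℕ) (w : List ℕ) (hw : ∀ v ∈ w, v < a) (g : ℕ → M) :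
    ((insertTwice a w).map fun w' => g (ascentPlateaus w')).sum =
      2 * ascentPlateaus w * g (ascentPlateaus w) +
        (w.length - 2 * ascentPlateaus w) * g (ascentPlateaus w + 1) := by
  induction hn : w.length using Nat.strong_induction_on generalizing w g with
  | _ n ih =>
    subst hn
    match w with
    | [] => simp [insertTwice, ascentPlateaus]
    | [b] => simp [insertTwice, ascentPlateaus, hw b]
    | [b, c] =>
      have hb : b < a := hw b (by simp)
      have hc : c < a := hw c (by simp)
      simp [insertTwice, ascentPlateaus, hb, hc, hc.ne, hc.ne']
      ring
    | b :: c :: d :: l =>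
      have hb : b < a := hw b (by simp)
      have hc : c < a := hw c (by simp)
      have hd : d < a := hw d (by simp)
      have hl : ∀ x ∈ l, x < a := fun x hx => hw x (by simp [hx])
      have hdl : ∀ x ∈ d :: l, x < a := fun x hx => hw x (by simp_all)
      have hcdl : ∀ x ∈ c :: d :: l, x < a := fun x hx => hw x (by simp_all)
      by_cases h : b < c ∧ c = d
      · obtain ⟨hbc, rfl⟩ := h
        have key := ih (l.length + 1) (by simp) (c :: l) hdl (fun k => g (k + 1)) (by simp)
        have e : ∀ x, ascentPlateaus (b :: c :: c :: x) = ascentPlateaus (c :: x) + 1 := fun x => by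
          rw [ascentPlateaus, if_pos ⟨hbc, rfl⟩, ascentPlateaus_cons_of_le (by simp), add_comm]
        have e1 : ascentPlateaus (b :: c :: a :: a :: c :: l) = ascentPlateaus (c :: l) + 1 := by
          rw [ascentPlateaus, if_neg (fun h => hc.ne h.2), ascentPlateaus_cons_insert hc hdl,
            zero_add]
        have e2 : ascentPlateaus (c :: c :: l) = ascentPlateaus (c :: l) :=
          ascentPlateaus_cons_of_le (by simp)
        simp only [insertTwice, List.map_cons, List.map_map, List.sum_cons, Function.comp_def, e,
          e1, e2, ascentPlateaus_cons_insert hb hcdl] at key ⊢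
        rw [key]
        push_cast [List.length_cons]
        ring
      · have key := ih (l.length + 2) (by simp) (c :: d :: l) hcdl g (by simp)
        have e : ∀ x, ascentPlateaus (b :: c :: d :: x) = ascentPlateaus (c :: d :: x) :=
          fun x => by rw [ascentPlateaus, if_neg h, zero_add]
        have e1 : ∀ x, ascentPlateaus (b :: c :: a :: x) = ascentPlateaus (c :: a :: x) :=
          fun x => by rw [ascentPlateaus, if_neg (fun h => hc.ne h.2), zero_add]
        simp only [insertTwice, List.map_cons, List.map_map, List.sum_cons, Function.comp_def, e,
          e1, ascentPlateaus_cons_insert hb hcdl] at key ⊢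
        rw [key]
        push_cast [List.length_cons]
        ring

lemma sum_insertInCycle (a : ℕ) (c : List (List ℕ)) (hc : ∀ w ∈ c, ∀ v ∈ w, v < a)
    (hlen : ∀ w ∈ c, 2 ≤ w.length) (g : ℕ → ℕ → M) :
    ((insertInCycle a c).map fun c' => g (capSt c') (fixSt c')).sum =
      2 * capSt c * g (capSt c) (fixSt c) + 2 * fixSt c * g (capSt c + 1) (fixSt c - 1) +
        (c.flatten.length - 2 * capSt c - 2 * fixSt c) * g (capSt c + 1) (fixSt c) := by
  induction c generalizing g with
  | nil => simp [insertInCycle, capSt_nil, fixSt_nil]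
  | cons w c ih =>
    have hnf : ∀ w' ∈ insertTwice a w, ¬ ∃ k, w' = [k, k] := by
      rintro w' hw' ⟨k, rfl⟩
      obtain ⟨l₁, l₂, -, e₁, e₂⟩ := mem_insertTwice.mp hw'
      have h1 := congrArg List.length e₁
      have h2 := congrArg List.length e₂
      have h3 := hlen w (by simp)
      simp at h1 h2
      omega
    have hfirst : ((insertTwice a w).map fun w' => g (capSt (w' :: c)) (fixSt (w' :: c))).sum =
        ((insertTwice a w).map fun w' => g (ascentPlateaus w' + capSt c) (fixSt c)).sum := by
      refine congrArg List.sum (List.map_congr_left fun w' hw' => ?_)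
      rw [capSt_cons, fixSt_cons, if_neg (hnf w' hw'), zero_add]
    have hsecond := ih (fun v hv => hc v (by simp [hv])) (fun v hv => hlen v (by simp [hv]))
      (fun k f => g (ascentPlateaus w + k) ((if ∃ k, w = [k, k] then 1 else 0) + f))
    rw [insertInCycle, List.map_append, List.sum_append, List.map_map, List.map_map]
    simp only [Function.comp_def]
    rw [hfirst, sum_insertTwice a w (hc w (by simp)) fun k => g (k + capSt c) (fixSt c)]
    simp only [capSt_cons, fixSt_cons]
    rw [hsecond]
    by_cases hw : ∃ k, w = [k, k]
    · obtain ⟨k, rfl⟩ := hw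
      have hk : ∃ j, [k, k] = [j, j] := ⟨k, rfl⟩
      simp only [if_pos hk]
      rcases Nat.eq_zero_or_pos (fixSt c) with h0 | h0
      · simp [h0, ascentPlateaus]
        ring_nf
      · obtain ⟨f, hf⟩ : ∃ f, fixSt c = f + 1 := ⟨fixSt c - 1, by omega⟩
        simp [hf, ascentPlateaus, add_comm 1 f]
        ring_nf
    · simp only [if_neg hw, zero_add, List.flatten_cons, List.length_append]
      push_cast
      rw [show ascentPlateaus w + 1 + capSt c = ascentPlateaus w + capSt c + 1 by ring,
        show ascentPlateaus w + (capSt c + 1) = ascentPlateaus w + capSt c + 1 by ring]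
      ring

end InsertionStatistics

section Structure

lemma isStirlingWord_iff {l : List ℕ} :
    IsStirlingWord l ↔ ∀ x y, List.Sublist [x, y, x] l → x < y := by
  constructor
  · intro h x y hs
    obtain ⟨is, e, hp⟩ := List.sublist_eq_map_getElem hs
    match is with
    | [i, j, k] =>
      simp only [List.map_cons, List.map_nil, List.cons.injEq, and_true] at e
      simp only [List.pairwise_cons, List.mem_cons, List.not_mem_nil, or_false] at hp
      rw [e.1, e.2.1]
      exact h i j k (hp.1 j (by simp)) (hp.2.1 k rfl) (e.1.symm.trans e.2.2)
    | [] | [_] | [_, _] | _ :: _ :: _ :: _ :: _ => simp at e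
  · intro h i j k hij hjk hik
    refine h _ _ ?_
    have := List.map_getElem_sublist (l := l) (is := [i, j, k])
      (by simp [hij, hjk, hij.trans hjk])
    simp only [List.map_cons, List.map_nil] at this
    rw [show l[k] = l[i] from hik.symm] at this
    exact this

/-- The conditions imposed on each single cycle in `IsStirling2`. -/
def IsCycleWord (w : List ℕ) : Prop :=
  w ≠ [] ∧ (∀ v ∈ w, w.count v = 2) ∧ (∀ v ∈ w, w.headI ≤ v) ∧ IsStirlingWord w

lemma isStirling2_iff {n : ℕ} {c : List (List ℕ)} :
    IsStirling2 n c ↔ c.flatten.Perm (baseList n) ∧ (∀ w ∈ c, IsCycleWord w) ∧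
      (c.map List.headI).Pairwise (· < ·) := by
  rw [← List.isChain_iff_pairwise, List.isChain_map]
  rfl

lemma filter_ne_eq_self {a : ℕ} {l : List ℕ} (hl : a ∉ l) :
    l.filter (fun v => decide (v ≠ a)) = l :=
  List.filter_eq_self.mpr fun v hv => by simpa using fun h : v = a => hl (h ▸ hv)

lemma isStirlingWord_insert {a : ℕ} {l₁ l₂ : List ℕ} (h : ∀ v ∈ l₁ ++ l₂, v < a) :
    IsStirlingWord (l₁ ++ a :: a :: l₂) ↔ IsStirlingWord (l₁ ++ l₂) := by
  have ha₁ : a ∉ l₁ := fun h' => (h a (by simp [h'])).false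
  have ha₂ : a ∉ l₂ := fun h' => (h a (by simp [h'])).false
  rw [isStirlingWord_iff, isStirlingWord_iff]
  constructor
  · intro hs x y hxy
    exact hs x y (hxy.trans (List.Sublist.append_left (by simp) l₁))
  · intro hs x y hxy
    have hcount := hxy.count_le a
    have hy : y ∈ l₁ ++ a :: a :: l₂ := hxy.subset (by simp)
    have hx : x ∈ l₁ ++ a :: a :: l₂ := hxy.subset (by simp)
    have key : ∀ v ∈ l₁ ++ a :: a :: l₂, v ≠ a → v < a := fun v hv hva =>
      h v (by simp_all)
    by_cases hxa : x = a
    · subst hxa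
      exfalso
      have hya : y ≠ x := by
        rintro rfl
        simp [List.count_eq_zero_of_not_mem ha₁, List.count_eq_zero_of_not_mem ha₂] at hcount
      obtain ⟨s₁, s₂, e, h₁, h₂⟩ := List.sublist_append_iff.mp hxy
      cases s₁ with
      | cons z s₁ =>
        obtain ⟨rfl, -⟩ : x = z ∧ [y, x] = s₁ ++ s₂ := by simpa using e
        exact ha₁ (h₁.subset (by simp))
      | nil =>
        rw [List.nil_append] at e
        rw [← e, List.cons_sublist_cons, List.sublist_cons_iff] at h₂
        rcases h₂ with h₂ | ⟨r, hr, -⟩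
        · exact ha₂ (h₂.subset (by simp))
        · exact hya (List.cons.inj hr).1
    · by_cases hya : y = a
      · exact hya ▸ key x hx hxa
      · have hf := hxy.filter (fun v => decide (v ≠ a))
        refine hs x y ?_
        rwa [filter_ne_eq_self (by simp [Ne.symm hxa, Ne.symm hya]), List.filter_append,
          filter_ne_eq_self ha₁, List.filter_cons_of_neg (by simp),
          List.filter_cons_of_neg (by simp), filter_ne_eq_self ha₂] at hf

lemma headI_append {l₁ : List ℕ} (h : l₁ ≠ []) (l₂ : List ℕ) : (l₁ ++ l₂).headI = l₁.headI := by
  obtain ⟨x, l, rfl⟩ := List.exists_cons_of_ne_nil h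
  rfl

lemma isCycleWord_insert {a : ℕ} {l₁ l₂ : List ℕ} (h₁ : l₁ ≠ []) (h : ∀ v ∈ l₁ ++ l₂, v < a) :
    IsCycleWord (l₁ ++ a :: a :: l₂) ↔ IsCycleWord (l₁ ++ l₂) := by
  have ha₁ : a ∉ l₁ := fun h' => (h a (by simp [h'])).false
  have ha₂ : a ∉ l₂ := fun h' => (h a (by simp [h'])).false
  have hcount : ∀ v ≠ a, (l₁ ++ a :: a :: l₂).count v = (l₁ ++ l₂).count v := fun v hv => by
    simp [List.count_append, hv.symm]
  have hcount' : (l₁ ++ a :: a :: l₂).count a = 2 := by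
    simp [List.count_eq_zero_of_not_mem ha₁, List.count_eq_zero_of_not_mem ha₂]
  have hmem : ∀ v, v ∈ l₁ ++ a :: a :: l₂ ↔ v = a ∨ v ∈ l₁ ++ l₂ := fun v => by
    simp; tauto
  have hhead : l₁.headI < a := h _ (by
    obtain ⟨x, l, rfl⟩ := List.exists_cons_of_ne_nil h₁
    simp)
  rw [IsCycleWord, IsCycleWord, isStirlingWord_insert h, headI_append h₁, headI_append h₁]
  refine and_congr (by simp [h₁]) (and_congr ?_ (and_congr_left fun _ => ?_))
  · constructor
    · intro H v hv
      rw [← hcount v (h v hv).ne, H v ((hmem v).mpr (Or.inr hv))]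
    · intro H v hv
      rcases (hmem v).mp hv with rfl | hv'
      · exact hcount'
      · rw [hcount v (h v hv').ne, H v hv']
  · constructor
    · intro H v hv
      exact H v ((hmem v).mpr (Or.inr hv))
    · intro H v hv
      rcases (hmem v).mp hv with rfl | hv'
      · exact hhead.le
      · exact H v hv'

lemma baseList_succ (n : ℕ) : baseList (n + 1) = baseList n ++ [n + 1, n + 1] := by
  simp [baseList, List.range_succ]

lemma mem_baseList {n v : ℕ} : v ∈ baseList n ↔ 1 ≤ v ∧ v ≤ n := by
  induction n with
  | zero => simp [baseList]; omega
  | succ n ih =>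
    rw [baseList_succ, List.mem_append, ih]
    simp
    omega

lemma length_baseList (n : ℕ) : (baseList n).length = 2 * n := by
  induction n with
  | zero => rfl
  | succ n ih => rw [baseList_succ, List.length_append, ih]; simp; ring

namespace IsStirling2

variable {n : ℕ} {c c' : List (List ℕ)}

lemma le (h : IsStirling2 n c) : ∀ w ∈ c, ∀ v ∈ w, v ≤ n := fun _ hw _ hv =>
  (mem_baseList.mp (h.1.subset (List.mem_flatten_of_mem hw hv))).2

lemma lt (h : IsStirling2 n c) : ∀ w ∈ c, ∀ v ∈ w, v < n + 1 := fun w hw v hv =>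
  Nat.lt_succ_of_le (h.le w hw v hv)

lemma two_le_length (h : IsStirling2 n c) : ∀ w ∈ c, 2 ≤ w.length := by
  intro w hw
  obtain ⟨hne, hcount, -⟩ := h.2.1 w hw
  obtain ⟨v, l, rfl⟩ := List.exists_cons_of_ne_nil hne
  exact (hcount v (by simp)).symm.le.trans List.count_le_length

lemma length_flatten (h : IsStirling2 n c) : c.flatten.length = 2 * n := by
  rw [h.1.length_eq, length_baseList]

lemma append_fixed (h : IsStirling2 n c) : IsStirling2 (n + 1) (c ++ [[n + 1, n + 1]]) := by
  obtain ⟨hp, hw, hc⟩ := isStirling2_iff.mp h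
  refine isStirling2_iff.mpr ⟨?_, ?_, ?_⟩
  · rw [baseList_succ, List.flatten_append]
    exact hp.append (by simp)
  · intro w hw'
    rw [List.mem_append, List.mem_singleton] at hw'
    rcases hw' with hw' | rfl
    · exact hw w hw'
    · refine ⟨by simp, by simp, by simp, fun i j k hij hjk => ?_⟩
      have := k.isLt
      simp only [List.length_cons, List.length_nil] at this
      omega
  · rw [List.map_append, List.pairwise_append]
    refine ⟨hc, by simp, ?_⟩
    intro x hx y hy
    obtain ⟨w, hwc, rfl⟩ := List.mem_map.mp hx
    obtain rfl : y = n + 1 := by simpa using hy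
    obtain ⟨v, l, rfl⟩ := List.exists_cons_of_ne_nil (hw w hwc).1
    exact h.lt _ hwc v (by simp)

lemma insert_iff {c₁ c₂ : List (List ℕ)} {l₁ l₂ : List ℕ} (h₁ : l₁ ≠ [])
    (h : ∀ v ∈ l₁ ++ l₂, v < n + 1) :
    IsStirling2 (n + 1) (c₁ ++ (l₁ ++ (n + 1) :: (n + 1) :: l₂) :: c₂) ↔
      IsStirling2 n (c₁ ++ (l₁ ++ l₂) :: c₂) := by
  rw [isStirling2_iff, isStirling2_iff]
  refine and_congr ?_ (and_congr ?_ ?_)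
  · have e : (c₁ ++ (l₁ ++ (n + 1) :: (n + 1) :: l₂) :: c₂).flatten.Perm
        ((c₁ ++ (l₁ ++ l₂) :: c₂).flatten ++ [n + 1, n + 1]) := by
      rw [List.perm_iff_count]
      intro v
      simp only [List.flatten_append, List.flatten_cons, List.count_append, List.count_cons,
        List.count_nil]
      omega
    rw [baseList_succ, e.congr_left, List.perm_append_right_iff]
  · simp only [List.mem_append, List.mem_cons, or_imp, forall_and, forall_eq,
      isCycleWord_insert h₁ h]
  · simp only [List.map_append, List.map_cons, headI_append h₁]

lemma of_mem_insertInCycle (h : IsStirling2 n c) (hc' : c' ∈ insertInCycle (n + 1) c) :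
    IsStirling2 (n + 1) c' := by
  obtain ⟨c₁, w, w', c₂, hw', rfl, rfl⟩ := mem_insertInCycle.mp hc'
  obtain ⟨l₁, l₂, h₁, rfl, rfl⟩ := mem_insertTwice.mp hw'
  exact (insert_iff h₁ (h.lt _ (by simp))).mpr h

lemma exists_eq_insert {w : List ℕ} {a : ℕ} (hw : IsCycleWord w) (ha : a ∈ w)
    (hmax : ∀ v ∈ w, v ≤ a) :
    ∃ l₁ l₂, w = l₁ ++ a :: a :: l₂ ∧ ∀ v ∈ l₁ ++ l₂, v < a := by
  obtain ⟨l₁, t, rfl, ha₁⟩ := List.eq_append_cons_of_mem ha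
  have hct : t.count a = 1 := by
    have := hw.2.1 a ha
    simp [List.count_eq_zero_of_not_mem ha₁] at this
    exact this
  have hat : a ∈ t := List.count_pos_iff.mp (by omega)
  match t with
  | y :: l₂ =>
    have hya : y = a := by
      by_contra hne
      have hal : a ∈ l₂ := by simpa [Ne.symm hne] using hat
      have hs := isStirlingWord_iff.mp hw.2.2.2 a y
        (List.Sublist.trans (by simpa using hal) (List.sublist_append_right l₁ _))
      exact absurd (hmax y (by simp)) hs.not_ge
    subst hya
    have ha₂ : y ∉ l₂ := List.count_eq_zero.mp (by simpa using hct)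
    refine ⟨l₁, l₂, rfl, fun v hv => lt_of_le_of_ne (hmax v ?_) ?_⟩
    · simp at hv ⊢
      tauto
    · rintro rfl
      simp at hv
      tauto

lemma exists_parent (h : IsStirling2 (n + 1) c') :
    ∃ c, IsStirling2 n c ∧ (c' = c ++ [[n + 1, n + 1]] ∨ c' ∈ insertInCycle (n + 1) c) := by
  obtain ⟨hp, hw, hc⟩ := isStirling2_iff.mp h
  have ha : n + 1 ∈ c'.flatten := hp.symm.subset (mem_baseList.mpr ⟨by omega, le_rfl⟩)
  obtain ⟨w, hwc, haw⟩ := List.mem_flatten.mp ha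
  obtain ⟨l₁, l₂, rfl, hlt⟩ := exists_eq_insert (hw w hwc) haw (h.le w hwc)
  obtain ⟨c₁, c₂, rfl⟩ := List.append_of_mem hwc
  rcases eq_or_ne l₁ [] with rfl | h₁
  · have hl₂ : l₂ = [] := by
      refine List.eq_nil_iff_forall_not_mem.mpr fun v hv => ?_
      have h1 := (hw _ hwc).2.2.1 v (by simp [hv])
      have h2 := hlt v (by simp [hv])
      simp at h1
      omega
    subst hl₂
    have hc₂ : c₂ = [] := by
      refine List.eq_nil_iff_forall_not_mem.mpr fun v hv => ?_
      rw [List.map_append, List.map_cons, List.pairwise_append, List.pairwise_cons] at hc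
      have h1 := hc.2.1.1 v.headI (List.mem_map_of_mem hv)
      have hv' : v ∈ c₁ ++ ([] ++ [n + 1, n + 1]) :: c₂ := by simp [hv]
      obtain ⟨x, l, rfl⟩ := List.exists_cons_of_ne_nil (hw v hv').1
      have h2 := h.le _ hv' x (by simp)
      simp at h1
      omega
    subst hc₂
    refine ⟨c₁, isStirling2_iff.mpr ⟨?_, fun w hw' => hw w (by simp [hw']), ?_⟩, Or.inl rfl⟩
    · rw [baseList_succ, List.flatten_append] at hp
      exact (List.perm_append_right_iff [n + 1, n + 1]).mp (by simpa using hp)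
    · rw [List.map_append, List.pairwise_append] at hc
      exact hc.1
  · exact ⟨_, (insert_iff h₁ hlt).mp h, Or.inr (mem_insertInCycle.mpr
      ⟨c₁, _, _, c₂, mem_insertTwice.mpr ⟨l₁, l₂, h₁, rfl, rfl⟩, rfl, rfl⟩)⟩

end IsStirling2

/-- Delete the value `a` from every cycle, and then the empty cycles. -/
def deleteValue (a : ℕ) (c : List (List ℕ)) : List (List ℕ) :=
  (c.map fun w => w.filter fun v => decide (v ≠ a)).filter fun w => decide (w ≠ [])

lemma deleteValue_append (a : ℕ) (c d : List (List ℕ)) :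
    deleteValue a (c ++ d) = deleteValue a c ++ deleteValue a d := by
  simp [deleteValue]

lemma deleteValue_eq_self {a : ℕ} {c : List (List ℕ)} (ha : ∀ w ∈ c, a ∉ w)
    (hne : ∀ w ∈ c, w ≠ []) : deleteValue a c = c := by
  rw [deleteValue, List.map_congr_left fun w hw => filter_ne_eq_self (ha w hw), List.map_id',
    List.filter_eq_self]
  simpa using hne

/-- The results of adding the value `a` to a list of cycles. -/
def children (a : ℕ) (c : List (List ℕ)) : List (List (List ℕ)) :=
  (c ++ [[a, a]]) :: insertInCycle a c

lemma children_nodup {a : ℕ} {c : List (List ℕ)} (ha : ∀ w ∈ c, a ∉ w) :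
    (children a c).Nodup := by
  refine List.nodup_cons.mpr ⟨fun h => ?_, insertInCycle_nodup ha⟩
  obtain ⟨c₁, w, w', c₂, -, e₁, e₂⟩ := mem_insertInCycle.mp h
  have h₁ := congrArg List.length e₁
  have h₂ := congrArg List.length e₂
  simp at h₁ h₂
  omega

lemma deleteValue_of_mem_children {a : ℕ} {c c' : List (List ℕ)} (ha : ∀ w ∈ c, a ∉ w)
    (hne : ∀ w ∈ c, w ≠ []) (h : c' ∈ children a c) : deleteValue a c' = c := by
  rcases List.mem_cons.mp h with rfl | h
  · rw [deleteValue_append, deleteValue_eq_self ha hne]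
    simp [deleteValue]
  · obtain ⟨c₁, w, w', c₂, hw', rfl, rfl⟩ := mem_insertInCycle.mp h
    obtain ⟨l₁, l₂, h₁, rfl, rfl⟩ := mem_insertTwice.mp hw'
    have e : deleteValue a [l₁ ++ a :: a :: l₂] = deleteValue a [l₁ ++ l₂] := by
      simp [deleteValue]
    rw [List.append_cons, deleteValue_append, deleteValue_append, e, ← deleteValue_append,
      ← deleteValue_append, ← List.append_cons, deleteValue_eq_self ha hne]

lemma mem_stirling2 {n : ℕ} {c : List (List ℕ)} : c ∈ stirling2 n ↔ IsStirling2 n c := by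
  rw [stirling2, Finset.mem_filter, and_iff_right_iff_imp]
  intro h
  have hsum : (c.map List.length).sum = 2 * n := by
    rw [← List.length_flatten, h.length_flatten]
  refine Finset.mem_image.mpr ⟨⟨c.flatten, ⟨c.map List.length, ?_, hsum⟩⟩, ?_, ?_⟩
  · intro i hi
    obtain ⟨w, hw, rfl⟩ := List.mem_map.mp hi
    exact List.length_pos_iff.mpr (h.2.1 w hw).1
  · simpa using h.1
  · have key : ∀ m (_ : c.flatten.length = m) (K : Composition m),
        c.map List.length = K.blocks → c.flatten.splitWrtComposition K = c := by
      rintro _ rfl K hK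
      exact List.splitWrtComposition_flatten _ _ hK
    exact key _ h.length_flatten _ rfl

lemma stirling2_zero : stirling2 0 = {[]} := by
  ext c
  rw [mem_stirling2, Finset.mem_singleton]
  constructor
  · intro h
    refine List.eq_nil_iff_forall_not_mem.mpr fun w hw => ?_
    have h1 := h.two_le_length w hw
    have h2 := h.length_flatten
    rw [List.length_flatten] at h2
    have h3 := List.single_le_sum (l := c.map List.length) (by simp) w.length
      (List.mem_map_of_mem hw)
    omega
  · rintro rfl
    exact ⟨by simp [baseList], by simp, List.isChain_nil⟩

lemma stirling2_succ (n : ℕ) :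
    stirling2 (n + 1) = (stirling2 n).biUnion fun c => (children (n + 1) c).toFinset := by
  ext c'
  simp only [mem_stirling2, Finset.mem_biUnion, List.mem_toFinset, children, List.mem_cons]
  constructor
  · exact fun h => h.exists_parent
  · rintro ⟨c, h, rfl | h'⟩
    · exact h.append_fixed
    · exact h.of_mem_insertInCycle h'

lemma sum_stirling2_succ {M : Type*} [CommRing M] (n : ℕ) (g : ℕ → ℕ → M) :
    ∑ c ∈ stirling2 (n + 1), g (capSt c) (fixSt c) =
      ∑ c ∈ stirling2 n, (g (capSt c) (fixSt c + 1) + (2 * capSt c * g (capSt c) (fixSt c) +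
        2 * fixSt c * g (capSt c + 1) (fixSt c - 1) +
          (2 * n - 2 * capSt c - 2 * fixSt c) * g (capSt c + 1) (fixSt c))) := by
  have hnot : ∀ c ∈ stirling2 n, ∀ w ∈ c, n + 1 ∉ w := fun c hc w hw h =>
    ((mem_stirling2.mp hc).lt w hw _ h).false
  have hne : ∀ c ∈ stirling2 n, ∀ w ∈ c, w ≠ [] := fun c hc w hw =>
    ((mem_stirling2.mp hc).2.1 w hw).1
  rw [stirling2_succ, Finset.sum_biUnion]
  · refine Finset.sum_congr rfl fun c hc => ?_
    have h := mem_stirling2.mp hc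
    have hfix : ascentPlateaus [n + 1, n + 1] = 0 := rfl
    have hk : ∃ k, [n + 1, n + 1] = [k, k] := ⟨n + 1, rfl⟩
    rw [List.sum_toFinset _ (children_nodup (hnot c hc)), children, List.map_cons, List.sum_cons,
      sum_insertInCycle _ _ h.lt h.two_le_length g, h.length_flatten, capSt_append, fixSt_append,
      capSt_cons, fixSt_cons, hfix, if_pos hk, capSt_nil, fixSt_nil]
    push_cast
    rfl
  · intro c hc d hd hcd
    refine Finset.disjoint_left.mpr fun c' h₁ h₂ => hcd ?_
    rw [List.mem_toFinset] at h₁ h₂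
    rw [← deleteValue_of_mem_children (hnot c hc) (hne c hc) h₁,
      deleteValue_of_mem_children (hnot d hd) (hne d hd) h₂]

end Structure

section Recurrence

open Polynomial

/-- The ascent plateau polynomial of the elements of `Q_n²` with exactly `f` fixed points. -/
def fixPoly (n f : ℕ) : ℝ[X] :=
  ∑ σ ∈ stirling2 n, if fixSt σ = f then X ^ capSt σ else 0

lemma Rx_eq_fixPoly (n : ℕ) : Rx n = fixPoly n 0 := by
  rw [Rx, fixPoly, Finset.sum_filter]

lemma fixPoly_zero (f : ℕ) : fixPoly 0 f = if f = 0 then 1 else 0 := by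
  rw [fixPoly, stirling2_zero, Finset.sum_singleton, capSt_nil, fixSt_nil, pow_zero]
  simp only [eq_comm]

lemma insertion_weight_eq (n f k j : ℕ) :
    (2 * (k : ℝ[X]) * (if j = f then (X : ℝ[X]) ^ k else 0) +
        2 * (j : ℝ[X]) * (if j - 1 = f then (X : ℝ[X]) ^ (k + 1) else 0) +
        (2 * (n : ℝ[X]) - 2 * (k : ℝ[X]) - 2 * (j : ℝ[X])) *
          (if j = f then (X : ℝ[X]) ^ (k + 1) else 0)) =
      2 * (X : ℝ[X]) * ((f : ℝ[X]) + 1) * (if j = f + 1 then (X : ℝ[X]) ^ k else 0) +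
        (2 * (n : ℝ[X]) - 2 * (f : ℝ[X])) * X * (if j = f then (X : ℝ[X]) ^ k else 0) +
        2 * X * (1 - X) * derivative (if j = f then (X : ℝ[X]) ^ k else 0) := by
  have hd : X * derivative ((X : ℝ[X]) ^ k) = (k : ℝ[X]) * X ^ k := by
    rw [derivative_X_pow]
    cases k with
    | zero => simp
    | succ k =>
      rw [Nat.add_sub_cancel, pow_succ, map_natCast]
      ring
  have hj : (j : ℝ[X]) * (if j - 1 = f then (X : ℝ[X]) ^ (k + 1) else 0) =
      ((f : ℝ[X]) + 1) * (if j = f + 1 then (X : ℝ[X]) ^ (k + 1) else 0) := by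
    cases j with
    | zero => simp
    | succ j => by_cases h : j = f <;> simp [h]
  have e : ∀ P : Prop, [Decidable P] → (if P then (X : ℝ[X]) ^ (k + 1) else 0) =
      X * (if P then (X : ℝ[X]) ^ k else 0) := fun P _ => by
    split_ifs
    · ring
    · simp
  rw [mul_assoc 2 (j : ℝ[X]), hj]
  by_cases h : j = f
  · subst h
    simp only [if_true, e]
    linear_combination (-2 * (1 - X)) * hd
  · simp only [if_neg h, e, derivative_zero]
    ring

lemma fixPoly_step (n f : ℕ) :
    fixPoly (n + 1) f = (∑ σ ∈ stirling2 n, if fixSt σ + 1 = f then X ^ capSt σ else 0) +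
      (2 * X * ((f : ℝ[X]) + 1) * fixPoly n (f + 1) +
        (2 * (n : ℝ[X]) - 2 * (f : ℝ[X])) * X * fixPoly n f +
        2 * X * (1 - X) * derivative (fixPoly n f)) := by
  rw [fixPoly, sum_stirling2_succ n fun k j => if j = f then (X : ℝ[X]) ^ k else 0,
    Finset.sum_add_distrib]
  congr 1
  simp only [insertion_weight_eq]
  rw [Finset.sum_add_distrib, Finset.sum_add_distrib, ← Finset.mul_sum, ← Finset.mul_sum,
    ← Finset.mul_sum, ← derivative_sum]
  rfl

lemma fixPoly_step_zero (n : ℕ) :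
    fixPoly (n + 1) 0 = 2 * X * fixPoly n 1 + 2 * (n : ℝ[X]) * X * fixPoly n 0 +
      2 * X * (1 - X) * derivative (fixPoly n 0) := by
  rw [fixPoly_step]
  simp

lemma fixPoly_step_succ (n f : ℕ) :
    fixPoly (n + 1) (f + 1) = fixPoly n f + (2 * X * ((f : ℝ[X]) + 2) * fixPoly n (f + 1 + 1) +
      (2 * (n : ℝ[X]) - 2 * ((f : ℝ[X]) + 1)) * X * fixPoly n (f + 1) +
        2 * X * (1 - X) * derivative (fixPoly n (f + 1))) := by
  rw [fixPoly_step]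
  simp only [Nat.add_right_cancel_iff]
  push_cast
  rw [show (f : ℝ[X]) + 1 + 1 = f + 2 by ring]
  rfl

lemma fixPoly_succ_succ (n f : ℕ) :
    ((f : ℝ[X]) + 1) * fixPoly (n + 1) (f + 1) = ((n : ℝ[X]) + 1) * fixPoly n f := by
  induction n generalizing f with
  | zero =>
    rw [fixPoly_step_succ]
    simp only [fixPoly_zero]
    cases f <;> simp
  | succ n ih =>
    have h1 := ih f
    have h2 := ih (f + 1)
    have h1' := congrArg derivative h1
    simp only [derivative_mul, derivative_add, derivative_natCast, derivative_one, add_zero,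
      zero_mul, zero_add] at h1'
    push_cast at h2 ⊢
    rw [fixPoly_step_succ (n + 1)]
    push_cast
    cases f with
    | zero =>
      have h3 := fixPoly_step_zero n
      push_cast at *
      linear_combination 2 * X * h2 + 2 * (n : ℝ[X]) * X * h1 + 2 * X * (1 - X) * h1' -
        ((n : ℝ[X]) + 1) * h3
    | succ f =>
      have h3 := fixPoly_step_succ n f
      have h4 := ih f
      push_cast at *
      linear_combination 2 * X * ((f : ℝ[X]) + 2) * h2 +
        (2 * (n : ℝ[X]) - 2 * ((f : ℝ[X]) + 1)) * X * h1 + 2 * X * (1 - X) * h1' -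
        ((n : ℝ[X]) + 1) * h3 + h4

lemma isDerangementSeq_Rx : IsDerangementSeq Rx where
  zero := by rw [Rx_eq_fixPoly, fixPoly_zero, if_pos rfl]
  one := by
    rw [Rx_eq_fixPoly, fixPoly_step_zero]
    simp [fixPoly_zero]
  step n := by
    have h := fixPoly_succ_succ n 0
    simp only [Rx_eq_fixPoly]
    rw [fixPoly_step_zero]
    simp only [map_mul, map_add, map_natCast, map_one, map_ofNat]
    push_cast at h ⊢
    rw [zero_add] at h
    linear_combination 2 * (X : ℝ[X]) * h

end Recurrence

/-- For every `n ≥ 2`, the polynomial `R_n(x)` is symmetric — its coefficients are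
palindromic about the center of its support:  `r_j = r_{D-j}` for `j ≤ D`, where
`D = natDegree + natTrailingDegree` (degree plus order of vanishing at `0`) — and all
of its zeros are real and simple. -/
theorem stmt19 (n : ℕ) (hn : 2 ≤ n) :
    (∀ j ≤ (Rx n).natDegree + (Rx n).natTrailingDegree,
      (Rx n).coeff j = (Rx n).coeff ((Rx n).natDegree + (Rx n).natTrailingDegree - j)) ∧
    (∀ z : ℂ, Polynomial.aeval z (Rx n) = 0 → z.im = 0) ∧
    (∀ x : ℝ, (Rx n).rootMultiplicity x ≤ 1) := by
  obtain ⟨n, rfl⟩ : ∃ k, n = k + 2 := ⟨n - 2, by omega⟩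
  have h := isDerangementSeq_Rx
  refine ⟨fun j hj => ?_, h.im_eq_zero_of_aeval_eq_zero n, h.rootMultiplicity_le_one n⟩
  rw [h.natDegree_eq, h.natTrailingDegree_eq] at hj ⊢
  exact h.coeff_symm (n + 2) _ _ (by omega)
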